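/- arXiv:2412.16387 — 6 statements merged into one kernel-verified Lean document; each statement's English description precedes it below -/
import Mathlib

section
/- Let a > 0 and c > 0 be constants with a > 1 + c, and set p_n = a·log n/n. Then for every constant c' with 0 < c' < c there is N such that for all n ≥ N, the probability that the Erdős–Rényi random graph G(n, p_n) is connected is at least 1 − n^{−c'}. -/
/-!
Erdős–Rényi random graphs `G(n,p)`: each of the `C(n,2)` unordered pairs of
distinct vertices is an edge independently with probability `p`.
-/

open scoped BigOperators

namespace ErdosRenyi

/-- Ordered pairs of distinct vertices `{(i,j) : i < j}`. -/
abbrev EPair (n : ℕ) := {e : Fin n × Fin n // e.1 < e.2}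

/-- A configuration records, for each pair, whether the edge is present. -/
abbrev EConfig (n : ℕ) := EPair n → Bool

/-- The probability of a given configuration in `G(n,p)`. -/
noncomputable def erWeight (n : ℕ) (p : ℝ) (ω : EConfig n) : ℝ :=
  ∏ e : EPair n, (if ω e then p else 1 - p)

/-- The probability of a set of configurations in `G(n,p)`. -/
noncomputable def erProb (n : ℕ) (p : ℝ) (S : Set (EConfig n)) : ℝ :=
  ∑ ω : EConfig n, S.indicator (erWeight n p) ω

/-- The simple graph determined by a configuration. -/
def graphOf {n : ℕ} (ω : EConfig n) : SimpleGraph (Fin n) :=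
  SimpleGraph.fromRel (fun i j => ∃ h : i < j, ω ⟨(i, j), h⟩ = true)

/-- The number of vertices of a largest connected component. -/
noncomputable def maxCompSize {n : ℕ} (H : SimpleGraph (Fin n)) : ℕ :=
  Finset.univ.sup (fun v => {w | H.Reachable v w}.ncard)

/-- The pair `{i, j}` in sorted order. -/
def mkPair {n : ℕ} (x : Fin n × Fin n) (h : x.1 ≠ x.2) : EPair n :=
  if h' : x.1 < x.2 then ⟨x, h'⟩ else ⟨(x.2, x.1), lt_of_le_of_ne (not_lt.mp h') h.symm⟩

open Classical in
/-- The pairs crossing the cut `(S, Sᶜ)`. -/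
noncomputable def cut {n : ℕ} (S : Finset (Fin n)) : Finset (EPair n) :=
  Finset.univ.filter (fun e => (e.1.1 ∈ S ∧ e.1.2 ∉ S) ∨ (e.1.2 ∈ S ∧ e.1.1 ∉ S))

lemma card_cut {n : ℕ} (S : Finset (Fin n)) : S.card * (n - S.card) ≤ (cut S).card := by
  classical
  have h1 : (S ×ˢ Sᶜ).card = S.card * (n - S.card) := by
    rw [Finset.card_product, Finset.card_compl, Fintype.card_fin]
  rw [← h1]
  have hne : ∀ x ∈ S ×ˢ Sᶜ, x.1 ≠ x.2 := by
    intro x hx h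
    simp only [Finset.mem_product, Finset.mem_compl] at hx
    exact hx.2 (h ▸ hx.1)
  let f : {x // x ∈ S ×ˢ Sᶜ} → EPair n := fun x => mkPair x.1 (hne x.1 x.2)
  have hf : Function.Injective f := by
    rintro ⟨⟨i, j⟩, hx⟩ ⟨⟨k, l⟩, hy⟩ hxy
    simp only [Finset.mem_product, Finset.mem_compl] at hx hy
    simp only [f, mkPair] at hxy
    split_ifs at hxy <;> simp only [Subtype.mk.injEq, Prod.mk.injEq] at hxy ⊢ <;> grind
  have himg : ∀ x ∈ Finset.univ, f x ∈ cut S := by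
    rintro ⟨⟨i, j⟩, hx⟩ _
    simp only [Finset.mem_product, Finset.mem_compl] at hx
    simp only [f, mkPair, cut, Finset.mem_filter, Finset.mem_univ, true_and]
    split_ifs
    · exact Or.inl hx
    · exact Or.inr hx
  have := Finset.card_le_card_of_injOn f himg hf.injOn
  simpa using this

lemma erProb_avoid {n : ℕ} (p : ℝ) (F : Finset (EPair n)) :
    erProb n p {ω | ∀ e ∈ F, ω e = false} = (1 - p) ^ F.card := by
  classical
  unfold erProb
  have h1 : ∀ ω : EConfig n, Set.indicator {ω | ∀ e ∈ F, ω e = false} (erWeight n p) ω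
      = ∏ e : EPair n, (fun (e : EPair n) (b : Bool) =>
        if e ∈ F then (if b then 0 else 1 - p) else (if b then p else 1 - p)) e (ω e) := by
    intro ω
    by_cases hω : ω ∈ {ω : EConfig n | ∀ e ∈ F, ω e = false}
    · rw [Set.indicator_of_mem hω]
      unfold erWeight
      refine Finset.prod_congr rfl fun e _ => ?_
      by_cases he : e ∈ F
      · simp [he, hω e he]
      · simp [he]
    · rw [Set.indicator_of_notMem hω]
      simp only [Set.mem_ofPred_eq, not_forall] at hω
      obtain ⟨e, he, hb⟩ := hω
      symm
      apply Finset.prod_eq_zero (Finset.mem_univ e)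
      simp [he, hb]
  rw [Finset.sum_congr rfl fun ω _ => h1 ω]
  have h3 := Fintype.prod_sum (fun (e : EPair n) (b : Bool) =>
        if e ∈ F then (if b then 0 else 1 - p) else (if b then p else 1 - p))
  refine Eq.trans (Eq.trans ?_ h3.symm) ?_
  · congr!
  have h2 : ∀ e : EPair n, ∑ b : Bool,
      (if e ∈ F then (if b then 0 else 1 - p) else (if b then p else 1 - p))
      = if e ∈ F then 1 - p else 1 := by
    intro e
    by_cases he : e ∈ F <;> simp [he]
  rw [Finset.prod_congr rfl fun e _ => h2 e]
  simp [Finset.prod_ite_mem]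

lemma erWeight_nonneg {n : ℕ} {p : ℝ} (h0 : 0 ≤ p) (h1 : p ≤ 1) (ω : EConfig n) :
    0 ≤ erWeight n p ω := by
  unfold erWeight
  refine Finset.prod_nonneg fun e _ => ?_
  split_ifs <;> linarith

lemma erWeight_sum {n : ℕ} (p : ℝ) : ∑ ω : EConfig n, erWeight n p ω = 1 := by
  have := erProb_avoid (n := n) p ∅
  simpa [erProb] using this

open Classical in
/-- Candidate small sides of a cut. -/
noncomputable def sides (n : ℕ) : Finset (Finset (Fin n)) :=
  Finset.univ.filter (fun S => S.Nonempty ∧ 2 * S.card ≤ n)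

lemma exists_cut {n : ℕ} (hn : 0 < n) (ω : EConfig n) (h : ¬ (graphOf ω).Connected) :
    ∃ S ∈ sides n, ∀ e ∈ cut S, ω e = false := by
  classical
  haveI : Nonempty (Fin n) := ⟨⟨0, hn⟩⟩
  have h' : ¬ (graphOf ω).Preconnected := fun hp => h ⟨hp⟩
  unfold SimpleGraph.Preconnected at h'
  push Not at h'
  obtain ⟨u, v, huv⟩ := h'
  set T : Finset (Fin n) := Finset.univ.filter (fun w => (graphOf ω).Reachable u w) with hT
  have hadj : ∀ x y, (graphOf ω).Adj x y → (x ∈ T ↔ y ∈ T) := by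
    intro x y hxy
    simp only [hT, Finset.mem_filter, Finset.mem_univ, true_and]
    exact ⟨fun h => h.trans hxy.reachable, fun h => h.trans hxy.symm.reachable⟩
  have hcut : ∀ e : EPair n, ω e = true → (e.1.1 ∈ T ↔ e.1.2 ∈ T) := by
    rintro ⟨⟨i, j⟩, hij⟩ he
    apply hadj
    simp only [graphOf, SimpleGraph.fromRel_adj]
    exact ⟨ne_of_lt hij, Or.inl ⟨hij, he⟩⟩
  have hu : u ∈ T := by simp [hT]
  have hv : v ∉ T := by simpa [hT] using huv
  have hc := Finset.card_add_card_compl T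
  rw [Fintype.card_fin] at hc
  by_cases hs : 2 * T.card ≤ n
  · refine ⟨T, by simp only [sides, Finset.mem_filter, Finset.mem_univ, true_and]; exact ⟨⟨u, hu⟩, hs⟩, ?_⟩
    intro e he
    simp only [cut, Finset.mem_filter, Finset.mem_univ, true_and] at he
    by_contra hb
    have := hcut e (by simpa using hb)
    tauto
  · refine ⟨Tᶜ, by simp only [sides, Finset.mem_filter, Finset.mem_univ, true_and]; exact ⟨⟨v, by simpa using hv⟩, by omega⟩, ?_⟩
    intro e he
    simp only [cut, Finset.mem_filter, Finset.mem_univ, true_and, Finset.mem_compl] at he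
    by_contra hb
    have := hcut e (by simpa using hb)
    tauto

lemma union_bound {n : ℕ} (hn : 0 < n) {p : ℝ} (h0 : 0 ≤ p) (h1 : p ≤ 1) :
    1 - ∑ S ∈ sides n, Real.exp (-(p * (S.card * (n - S.card : ℝ)))) ≤
      erProb n p {ω | (graphOf ω).Connected} := by
  classical
  have hS : ∀ S ∈ sides n, erProb n p {ω | ∀ e ∈ cut S, ω e = false} ≤
      Real.exp (-(p * (S.card * (n - S.card : ℝ)))) := by
    intro S hS
    rw [erProb_avoid]
    have hle : S.card ≤ n := by simpa using S.card_le_univ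
    calc (1 - p) ^ (cut S).card ≤ (1 - p) ^ (S.card * (n - S.card)) :=
          pow_le_pow_of_le_one (by linarith) (by linarith) (card_cut S)
      _ ≤ (Real.exp (-p)) ^ (S.card * (n - S.card)) :=
          pow_le_pow_left₀ (by linarith) (Real.one_sub_le_exp_neg p) _
      _ = _ := by
          rw [← Real.exp_nat_mul]
          congr 1
          push_cast [Nat.cast_sub hle]
          ring
  have hmain : 1 ≤ erProb n p {ω | (graphOf ω).Connected} +
      ∑ S ∈ sides n, erProb n p {ω | ∀ e ∈ cut S, ω e = false} := by
    rw [← erWeight_sum (n := n) p]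
    unfold erProb
    rw [Finset.sum_comm, ← Finset.sum_add_distrib]
    refine Finset.sum_le_sum fun ω _ => ?_
    have hw := erWeight_nonneg h0 h1 ω
    have hnn : ∀ S ∈ sides n, 0 ≤
        Set.indicator {ω : EConfig n | ∀ e ∈ cut S, ω e = false} (erWeight n p) ω :=
      fun S _ => Set.indicator_apply_nonneg fun _ => hw
    by_cases hcon : (graphOf ω).Connected
    · rw [Set.indicator_of_mem (show ω ∈ {ω | (graphOf ω).Connected} from hcon)]
      linarith [Finset.sum_nonneg hnn]
    · rw [Set.indicator_of_notMem (show ω ∉ {ω | (graphOf ω).Connected} from hcon)]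
      obtain ⟨S, hS, hc⟩ := exists_cut hn ω hcon
      have := Finset.single_le_sum hnn hS
      rw [Set.indicator_of_mem (show ω ∈ {ω : EConfig n | ∀ e ∈ cut S, ω e = false} from hc)] at this
      linarith
  linarith [Finset.sum_le_sum hS]

lemma sum_bound {n : ℕ} (hn : 0 < n) {a ε : ℝ} (ha : 0 < a) (hε : 0 < ε)
    (hx : (n : ℝ) * Real.exp (-(a * (1 - ε) * Real.log n)) ≤ 1) :
    ∑ S ∈ sides n, Real.exp (-((a * Real.log n / n) * (S.card * (n - S.card : ℝ)))) ≤
      2 * (n * Real.exp (-(a * (1 - ε) * Real.log n))) +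
        2 ^ n * Real.exp (-(a * ε / 2 * (n * Real.log n))) := by
  classical
  set x := Real.exp (-(a * (1 - ε) * Real.log n)) with hxdef
  set y := Real.exp (-(a * ε / 2 * (n * Real.log n))) with hydef
  have hx0 : 0 < x := Real.exp_pos _
  have hy0 : 0 < y := Real.exp_pos _
  have hn' : (0 : ℝ) < n := by exact_mod_cast hn
  have hlog : 0 ≤ Real.log n := Real.log_natCast_nonneg n
  have hterm : ∀ S ∈ sides n,
      Real.exp (-((a * Real.log n / n) * (S.card * (n - S.card : ℝ)))) ≤ x ^ S.card + y := by
    intro S hS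
    simp only [sides, Finset.mem_filter, Finset.mem_univ, true_and] at hS
    have h2 : (2 : ℝ) * S.card ≤ n := by exact_mod_cast hS.2
    have hk : (0 : ℝ) ≤ S.card := Nat.cast_nonneg _
    have hL : 0 ≤ a * Real.log n := by positivity
    by_cases hs : (S.card : ℝ) ≤ ε * n
    · have : Real.exp (-((a * Real.log n / n) * (S.card * (n - S.card : ℝ)))) ≤ x ^ S.card := by
        rw [hxdef, ← Real.exp_nat_mul]
        apply Real.exp_le_exp.mpr
        have e : (a * Real.log n / n) * (S.card * (n - S.card : ℝ))
          = (a * Real.log n) * (S.card * ((n - S.card : ℝ) / n)) := by ring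
        have h3 : 1 - ε ≤ (n - S.card : ℝ) / n := by
          rw [le_div_iff₀ hn']; linarith
        have := mul_le_mul_of_nonneg_left (mul_le_mul_of_nonneg_left h3 hk) hL
        rw [e]; linarith
      linarith
    · have : Real.exp (-((a * Real.log n / n) * (S.card * (n - S.card : ℝ)))) ≤ y := by
        rw [hydef]
        apply Real.exp_le_exp.mpr
        push Not at hs
        have e : (a * Real.log n / n) * (S.card * (n - S.card : ℝ))
          = (a * Real.log n) * (S.card * ((n - S.card : ℝ) / n)) := by ring
        have h3 : 1 / 2 ≤ (n - S.card : ℝ) / n := by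
          rw [le_div_iff₀ hn']; linarith
        have h4 : ε * n * (1 / 2) ≤ S.card * ((n - S.card : ℝ) / n) :=
          mul_le_mul hs.le h3 (by norm_num) hk
        have := mul_le_mul_of_nonneg_left h4 hL
        rw [e]; linarith
      have := pow_pos hx0 S.card
      linarith
  have hsub : sides n ⊆ Finset.univ.erase ∅ := by
    intro S hS
    simp only [sides, Finset.mem_filter, Finset.mem_univ, true_and] at hS
    simp [hS.1.ne_empty]
  have htot : ∑ S : Finset (Fin n), x ^ S.card = (1 + x) ^ n := by
    have := Fintype.sum_pow_mul_eq_add_pow (Fin n) x 1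
    simpa [add_comm] using this
  have hsum : ∑ S ∈ sides n, x ^ S.card ≤ (1 + x) ^ n - 1 := by
    have h1 : ∑ S ∈ sides n, x ^ S.card ≤ ∑ S ∈ (Finset.univ : Finset (Finset (Fin n))).erase ∅, x ^ S.card :=
      Finset.sum_le_sum_of_subset_of_nonneg hsub fun _ _ _ => (pow_pos hx0 _).le
    have h2 := Finset.add_sum_erase Finset.univ (fun S : Finset (Fin n) => x ^ S.card)
      (Finset.mem_univ ∅)
    simp only [Finset.card_empty, pow_zero] at h2
    linarith
  have hexp : (1 + x) ^ n - 1 ≤ 2 * (n * x) := by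
    have h1 : (1 + x) ^ n ≤ Real.exp (n * x) := by
      rw [Real.exp_nat_mul]
      exact pow_le_pow_left₀ (by positivity) (by linarith [Real.add_one_le_exp x]) n
    have h0 : 0 ≤ n * x := by positivity
    have h2 := Real.abs_exp_sub_one_le (x := n * x) (by rw [abs_of_nonneg h0]; exact hx)
    rw [abs_of_nonneg h0] at h2
    linarith [le_abs_self (Real.exp (n * x) - 1)]
  have hcard : ((sides n).card : ℝ) ≤ 2 ^ n := by
    have : (sides n).card ≤ 2 ^ n := by
      refine (Finset.card_le_univ _).trans ?_
      simp
    exact_mod_cast this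
  calc _ ≤ ∑ S ∈ sides n, (x ^ S.card + y) := Finset.sum_le_sum hterm
    _ = ∑ S ∈ sides n, x ^ S.card + (sides n).card * y := by
        rw [Finset.sum_add_distrib, Finset.sum_const, nsmul_eq_mul]
    _ ≤ _ := by
        have := mul_le_mul_of_nonneg_right hcard hy0.le
        linarith

/-- If `a > 1 + c > 1` and `p_n = a·log n/n`, then for every
`0 < c' < c`, for all large `n`, `G(n, p_n)` is connected with probability at
least `1 − n^(−c')`. -/
theorem er_connected_whp (a c : ℝ) (ha : 0 < a) (hc : 0 < c) (h : 1 + c < a) :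
    ∀ c' : ℝ, 0 < c' → c' < c → ∃ N : ℕ, ∀ n : ℕ, N ≤ n →
      1 - (n : ℝ) ^ (-c') ≤
        erProb n (a * Real.log n / n) {ω | (graphOf ω).Connected} := by
  intro c' hc' hcc
  obtain ⟨ε, hεdef⟩ : ∃ ε : ℝ, ε = (a - 1 - c) / a := ⟨_, rfl⟩
  have hε : 0 < ε := by rw [hεdef]; apply div_pos <;> linarith
  have hae : a * (1 - ε) = 1 + c := by rw [hεdef]; field_simp; ring
  have hlogT : Filter.Tendsto (fun n : ℕ => Real.log n) Filter.atTop Filter.atTop :=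
    Real.tendsto_log_atTop.comp tendsto_natCast_atTop_atTop
  have hp1 : ∀ᶠ n : ℕ in Filter.atTop, Real.log n ≤ a⁻¹ * n := by
    have := (Real.isLittleO_log_id_atTop.comp_tendsto
      (tendsto_natCast_atTop_atTop (R := ℝ))).bound (inv_pos.mpr ha)
    filter_upwards [this] with n hn
    have hn2 : |Real.log n| ≤ a⁻¹ * (n : ℝ) := by simpa using hn
    exact (le_abs_self _).trans hn2
  have hev : ∀ᶠ n : ℕ in Filter.atTop, 1 - (n : ℝ) ^ (-c') ≤
        erProb n (a * Real.log n / n) {ω | (graphOf ω).Connected} := by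
    filter_upwards [hp1, Filter.eventually_gt_atTop 0,
      hlogT.eventually_ge_atTop (Real.log 4 / (c - c')),
      hlogT.eventually_ge_atTop ((2 + c') / (a * ε / 2))] with n hp hn hl1 hl2
    have hn' : (0 : ℝ) < n := by exact_mod_cast hn
    have hn1 : (1 : ℝ) ≤ n := by exact_mod_cast hn
    have hlog : 0 ≤ Real.log n := Real.log_natCast_nonneg n
    have hnexp : (n : ℝ) = Real.exp (Real.log n) := (Real.exp_log hn').symm
    have hnx : (n : ℝ) * Real.exp (-(a * (1 - ε) * Real.log n)) = Real.exp (-(c * Real.log n)) := by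
      rw [hae]
      nth_rewrite 1 [hnexp]
      rw [← Real.exp_add]
      congr 1; ring
    have hle1 : (n : ℝ) * Real.exp (-(a * (1 - ε) * Real.log n)) ≤ 1 := by
      rw [hnx, Real.exp_le_one_iff]
      have : 0 ≤ c * Real.log n := by positivity
      linarith
    have hU := union_bound hn (p := a * Real.log n / n) (by positivity) (by
      rw [div_le_one hn']
      have := mul_le_mul_of_nonneg_left hp ha.le
      rwa [← mul_assoc, mul_inv_cancel₀ ha.ne', one_mul] at this)
    have hB := sum_bound hn ha hε hle1
    rw [hnx] at hB
    have hr : (n : ℝ) ^ (-c') = Real.exp (-(c' * Real.log n)) := by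
      rw [Real.rpow_def_of_pos hn']; congr 1; ring
    have hA1 : 4 * Real.exp (-(c * Real.log n)) ≤ Real.exp (-(c' * Real.log n)) := by
      rw [div_le_iff₀ (by linarith)] at hl1
      have h4 : (4 : ℝ) = Real.exp (Real.log 4) := (Real.exp_log (by norm_num)).symm
      rw [h4, ← Real.exp_add]
      apply Real.exp_le_exp.mpr
      linarith
    have hA2 : 2 * (2 ^ n * Real.exp (-(a * ε / 2 * (n * Real.log n)))) ≤
        Real.exp (-(c' * Real.log n)) := by
      rw [div_le_iff₀ (by positivity)] at hl2
      have h2 : (2 : ℝ) ≤ Real.exp 1 := by linarith [Real.add_one_le_exp (1 : ℝ)]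
      have h2n : (2 : ℝ) ^ n ≤ Real.exp n := by
        have := pow_le_pow_left₀ (by norm_num) h2 n
        rwa [← Real.exp_nat_mul, mul_one] at this
      have hln : Real.log n ≤ n := (Real.log_le_sub_one_of_pos hn').trans (by linarith)
      calc 2 * (2 ^ n * Real.exp (-(a * ε / 2 * (n * Real.log n))))
          ≤ Real.exp 1 * (Real.exp n * Real.exp (-(a * ε / 2 * (n * Real.log n)))) := by gcongr
        _ = Real.exp (1 + (n + -(a * ε / 2 * (n * Real.log n)))) := by
            rw [Real.exp_add, Real.exp_add]
        _ ≤ _ := by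
            apply Real.exp_le_exp.mpr
            have h5 := mul_le_mul_of_nonneg_left hl2 hn'.le
            have h6 := mul_le_mul_of_nonneg_left hln hc'.le
            linarith
    rw [hr]
    linarith
  exact Filter.eventually_atTop.mp hev

end ErdosRenyi
end

section
/- Let 0 < a < 1 and β₁, β₂ > 0 be constants, and set p_n = a·log n/n. Then there exist a constant C > 0 and N such that for all n ≥ N, the probability that the size Z_n of a largest connected component of G(n, p_n) satisfies β₁·log n ≤ Z_n ≤ n − β₂·n/log log n is at most n^{−C·log n}. -/
/-!
Erdős–Rényi random graphs `G(n,p)`: each of the `C(n,2)` unordered pairs of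
distinct vertices is an edge independently with probability `p`.
-/

open scoped BigOperators

namespace ErdosRenyi

lemma erProb_union {ι : Type*} {n : ℕ} {p : ℝ} (h0 : 0 ≤ p) (h1 : p ≤ 1)
    (S : Set (EConfig n)) (I : Finset ι) (E : ι → Set (EConfig n))
    (h : ∀ ω ∈ S, ∃ i ∈ I, ω ∈ E i) :
    erProb n p S ≤ ∑ i ∈ I, erProb n p (E i) := by
  unfold erProb
  rw [Finset.sum_comm]
  refine Finset.sum_le_sum fun ω _ => ?_
  have hnn : ∀ i ∈ I, 0 ≤ (E i).indicator (erWeight n p) ω := fun i _ =>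
    Set.indicator_nonneg (fun x _ => erWeight_nonneg h0 h1 x) ω
  by_cases hω : ω ∈ S
  · obtain ⟨i, hi, hE⟩ := h ω hω
    refine le_trans ?_ (Finset.single_le_sum hnn hi)
    rw [Set.indicator_of_mem hω, Set.indicator_of_mem hE]
  · rw [Set.indicator_of_notMem hω]
    exact Finset.sum_nonneg hnn

lemma erProb_mono {n : ℕ} {p : ℝ} (h0 : 0 ≤ p) (h1 : p ≤ 1)
    {S T : Set (EConfig n)} (h : S ⊆ T) : erProb n p S ≤ erProb n p T := by
  have := erProb_union h0 h1 S ({()} : Finset Unit) (fun _ => T)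
    (fun ω hω => ⟨(), by simp, h hω⟩)
  simpa using this

lemma erProb_empty {n : ℕ} {p : ℝ} : erProb n p ∅ = 0 := by
  simp [erProb]

lemma erProb_cyl {n : ℕ} {p : ℝ} (S T : Finset (EPair n)) (hd : Disjoint S T) :
    erProb n p {ω | (∀ e ∈ S, ω e = true) ∧ (∀ e ∈ T, ω e = false)}
      = p ^ S.card * (1 - p) ^ T.card := by
  classical
  let g : EPair n → Bool → ℝ := fun e b =>
    if (e ∈ S ∧ b = false) ∨ (e ∈ T ∧ b = true) then 0 else (if b then p else 1 - p)
  have h1 : ∀ ω : EConfig n,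
      Set.indicator {ω | (∀ e ∈ S, ω e = true) ∧ (∀ e ∈ T, ω e = false)} (erWeight n p) ω
        = ∏ e, g e (ω e) := by
    intro ω
    by_cases hω : ω ∈ {ω : EConfig n | (∀ e ∈ S, ω e = true) ∧ (∀ e ∈ T, ω e = false)}
    · rw [Set.indicator_of_mem hω]
      unfold erWeight
      refine Finset.prod_congr rfl fun e _ => ?_
      have hn : ¬ ((e ∈ S ∧ ω e = false) ∨ (e ∈ T ∧ ω e = true)) := by
        rintro (⟨h, h'⟩ | ⟨h, h'⟩)
        · have := hω.1 e h; simp_all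
        · have := hω.2 e h; simp_all
      simp only [g, if_neg hn]
    · rw [Set.indicator_of_notMem hω]
      symm
      have : ∃ e, (e ∈ S ∧ ω e = false) ∨ (e ∈ T ∧ ω e = true) := by
        by_contra hc
        push Not at hc
        apply hω
        refine ⟨fun e he => ?_, fun e he => ?_⟩
        · have := (hc e).1 he; simpa using this
        · have := (hc e).2 he; simpa using this
      obtain ⟨e, he⟩ := this
      refine Finset.prod_eq_zero (Finset.mem_univ e) ?_
      simp only [g, if_pos he]
  have h2 : ∀ e, ∑ b, g e b = (if e ∈ S then p else 1) * (if e ∈ T then 1 - p else 1) := by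
    intro e
    have : e ∈ S → e ∉ T := fun h => Finset.disjoint_left.1 hd h
    by_cases hS : e ∈ S
    · have hT := this hS
      simp [g, hS, hT]
    · by_cases hT : e ∈ T
      · simp [g, hS, hT]
      · simp [g, hS, hT]
  unfold erProb
  rw [Finset.sum_congr rfl fun ω _ => h1 ω]
  have h3 := Finset.prod_univ_sum (fun _ : EPair n => (Finset.univ : Finset Bool)) g
  rw [Fintype.piFinset_univ] at h3
  rw [← h3, Finset.prod_congr rfl fun e _ => h2 e, Finset.prod_mul_distrib]
  congr 1
  · rw [Finset.prod_ite_mem, Finset.univ_inter, Finset.prod_const]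
  · rw [Finset.prod_ite_mem, Finset.univ_inter, Finset.prod_const]

lemma graphOf_adj {n : ℕ} (ω : EConfig n) (e : EPair n) :
    (graphOf ω).Adj e.1.1 e.1.2 ↔ ω e = true := by
  obtain ⟨⟨i, j⟩, h⟩ := e
  simp only at h
  simp only [graphOf, SimpleGraph.fromRel_adj]
  constructor
  · rintro ⟨_, ⟨_, h2⟩ | ⟨h3, _⟩⟩
    · exact h2
    · exact absurd h3 (lt_asymm h)
  · intro h2
    exact ⟨h.ne, Or.inl ⟨h, h2⟩⟩

/-- Edges `{w, f w}` with `w ∈ A \ {v}`. -/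
noncomputable def treeEdges {n : ℕ} (A : Finset (Fin n)) (v : Fin n) (f : Fin n → Fin n) :
    Finset (EPair n) := by
  classical
  exact Finset.univ.filter fun e => ∃ w ∈ A.erase v, s(e.1.1, e.1.2) = s(w, f w)

/-- Edges across the cut `(A, Aᶜ)`. -/
noncomputable def cutEdges {n : ℕ} (A : Finset (Fin n)) : Finset (EPair n) := by
  classical
  exact Finset.univ.filter fun e => ¬ (e.1.1 ∈ A ↔ e.1.2 ∈ A)

lemma exists_epair {n : ℕ} {i j : Fin n} (h : i ≠ j) :
    ∃ e : EPair n, s(e.1.1, e.1.2) = s(i, j) := by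
  rcases lt_or_gt_of_ne h with h | h
  · exact ⟨⟨(i, j), h⟩, rfl⟩
  · exact ⟨⟨(j, i), h⟩, Sym2.eq_swap⟩

lemma card_treeEdges {n : ℕ} (A : Finset (Fin n)) (v : Fin n) (f : Fin n → Fin n)
    (hne : ∀ w ∈ A.erase v, w ≠ f w)
    (hinj : ∀ w ∈ A.erase v, ∀ w' ∈ A.erase v, s(w, f w) = s(w', f w') → w = w') :
    (A.erase v).card ≤ (treeEdges A v f).card := by
  classical
  calc (A.erase v).card = ((A.erase v).image fun w => s(w, f w)).card := by
        rw [Finset.card_image_of_injOn]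
        intro w hw w' hw' h
        exact hinj w hw w' hw' h
    _ ≤ ((treeEdges A v f).image fun e => s(e.1.1, e.1.2)).card := by
        apply Finset.card_le_card
        intro x hx
        obtain ⟨w, hw, rfl⟩ := Finset.mem_image.1 hx
        obtain ⟨e, he⟩ := exists_epair (hne w hw)
        refine Finset.mem_image.2 ⟨e, ?_, he⟩
        simp only [treeEdges, Finset.mem_filter, Finset.mem_univ, true_and]
        exact ⟨w, hw, he⟩
    _ ≤ _ := Finset.card_image_le

lemma card_cutEdges {n : ℕ} (A : Finset (Fin n)) :
    A.card * (n - A.card) ≤ (cutEdges A).card := by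
  classical
  have hc : (Aᶜ).card = n - A.card := by rw [Finset.card_compl, Fintype.card_fin]
  calc A.card * (n - A.card) = ((A ×ˢ Aᶜ).image fun w => s(w.1, w.2)).card := by
        rw [Finset.card_image_of_injOn, Finset.card_product, hc]
        rintro ⟨x, y⟩ hw ⟨x', y'⟩ hw' h
        simp only [Finset.coe_product, Set.mem_prod, Finset.mem_coe, Finset.mem_compl] at hw hw'
        simp only [Sym2.eq_iff] at h
        rcases h with ⟨rfl, rfl⟩ | ⟨rfl, rfl⟩
        · rfl
        · exact absurd hw.1 hw'.2
    _ ≤ ((cutEdges A).image fun e => s(e.1.1, e.1.2)).card := by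
        apply Finset.card_le_card
        intro x hx
        obtain ⟨⟨i, j⟩, hw, rfl⟩ := Finset.mem_image.1 hx
        simp only [Finset.mem_product, Finset.mem_compl] at hw
        have hij : i ≠ j := fun h => hw.2 (h ▸ hw.1)
        obtain ⟨e, he⟩ := exists_epair hij
        refine Finset.mem_image.2 ⟨e, ?_, he⟩
        simp only [cutEdges, Finset.mem_filter, Finset.mem_univ, true_and]
        simp only [Sym2.eq_iff] at he
        rcases he with ⟨h1, h2⟩ | ⟨h1, h2⟩
        · rw [h1, h2]; tauto
        · rw [h1, h2]; tauto
    _ ≤ _ := Finset.card_image_le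

/-- The event that `A` is the component of `v`. -/
def compEvent {n : ℕ} (A : Finset (Fin n)) (v : Fin n) : Set (EConfig n) :=
  {ω | ∀ w, w ∈ A ↔ (graphOf ω).Reachable v w}

/-- Admissible parent functions. -/
def GoodPar {n : ℕ} (A : Finset (Fin n)) (v : Fin n) (f : Fin n → Fin n) : Prop :=
  (∀ w ∈ A.erase v, w ≠ f w) ∧ (∀ w ∈ A.erase v, f w ∈ A) ∧
  (∀ w ∈ A.erase v, ∀ w' ∈ A.erase v, s(w, f w) = s(w', f w') → w = w')

/-- The event that `f` is a parent function in the component `A` of `v`. -/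
def parEvent {n : ℕ} (A : Finset (Fin n)) (v : Fin n) (f : Fin n → Fin n) : Set (EConfig n) :=
  {ω | GoodPar A v f ∧ (∀ e ∈ treeEdges A v f, ω e = true) ∧ (∀ e ∈ cutEdges A, ω e = false)}

lemma parEvent_prob {n : ℕ} {p : ℝ} (h0 : 0 ≤ p) (h1 : p ≤ 1) (A : Finset (Fin n)) (v : Fin n)
    (f : Fin n → Fin n) :
    erProb n p (parEvent A v f) ≤ p ^ (A.erase v).card * (1 - p) ^ (A.card * (n - A.card)) := by
  classical
  by_cases hg : GoodPar A v f
  · refine (erProb_mono h0 h1 (T := {ω | (∀ e ∈ treeEdges A v f, ω e = true) ∧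
      (∀ e ∈ cutEdges A, ω e = false)}) fun ω hω => hω.2).trans ?_
    rw [erProb_cyl]
    · refine mul_le_mul (pow_le_pow_of_le_one h0 h1 (card_treeEdges A v f hg.1 hg.2.2))
        (pow_le_pow_of_le_one (by linarith) (by linarith) (card_cutEdges A))
        (pow_nonneg (by linarith) _) (pow_nonneg h0 _)
    · rw [Finset.disjoint_left]
      intro e he he'
      simp only [treeEdges, cutEdges, Finset.mem_filter, Finset.mem_univ, true_and] at he he'
      obtain ⟨w, hw, h⟩ := he
      have a1 := hg.2.1 w hw
      have a2 := Finset.mem_of_mem_erase hw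
      simp only [Sym2.eq_iff] at h
      apply he'
      rcases h with ⟨h1, h2⟩ | ⟨h1, h2⟩
      · rw [h1, h2]; tauto
      · rw [h1, h2]; tauto
  · have : parEvent A v f = ∅ := by
      ext ω; simp [parEvent, hg]
    rw [this, erProb_empty]
    exact mul_nonneg (pow_nonneg h0 _) (pow_nonneg (by linarith) _)

lemma exists_parent {V : Type*} (H : SimpleGraph V) (v w : V) (h : H.Reachable v w) (hne : w ≠ v) :
    ∃ u, H.Adj w u ∧ H.dist u v < H.dist w v := by
  obtain ⟨q, hq⟩ := h.symm.exists_walk_length_eq_dist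
  cases q with
  | nil => exact absurd rfl hne
  | @cons _ u _ hadj q' =>
    refine ⟨u, hadj, ?_⟩
    have := SimpleGraph.dist_le q'
    rw [SimpleGraph.Walk.length_cons] at hq
    omega

/-- Candidate parent functions. -/
noncomputable def parFuns {n : ℕ} (A : Finset (Fin n)) (v : Fin n) : Finset (Fin n → Fin n) := by
  classical
  exact Fintype.piFinset fun w => if w ∈ A.erase v then A else {w}

lemma card_parFuns {n : ℕ} (A : Finset (Fin n)) (v : Fin n) :
    (parFuns A v).card = A.card ^ (A.erase v).card := by
  classical
  unfold parFuns
  rw [Fintype.card_piFinset]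
  have : ∀ w, (if w ∈ A.erase v then A else {w}).card = if w ∈ A.erase v then A.card else 1 := by
    intro w; split_ifs <;> simp
  rw [Finset.prod_congr rfl fun w _ => this w, Finset.prod_ite_mem, Finset.univ_inter,
    Finset.prod_const]

lemma compEvent_sub {n : ℕ} (A : Finset (Fin n)) (v : Fin n) (ω : EConfig n)
    (hω : ω ∈ compEvent A v) : ∃ f ∈ parFuns A v, ω ∈ parEvent A v f := by
  classical
  have hω' : ∀ w, w ∈ A ↔ (graphOf ω).Reachable v w := hω
  have key : ∀ w, ∃ u, (w ∈ A.erase v →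
      (graphOf ω).Adj w u ∧ (graphOf ω).dist u v < (graphOf ω).dist w v) ∧
      (w ∉ A.erase v → u = w) := by
    intro w
    by_cases hw : w ∈ A.erase v
    · obtain ⟨u, hu⟩ := exists_parent (graphOf ω) v w ((hω' w).1 (Finset.mem_of_mem_erase hw))
        (Finset.ne_of_mem_erase hw)
      exact ⟨u, fun _ => hu, fun h => absurd hw h⟩
    · exact ⟨w, fun h => absurd h hw, fun _ => rfl⟩
  choose f hf1 hf2 using key
  have hfA : ∀ w ∈ A.erase v, f w ∈ A := fun w hw =>
    (hω' _).2 (((hω' w).1 (Finset.mem_of_mem_erase hw)).trans (hf1 w hw).1.reachable)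
  refine ⟨f, ?_, ⟨⟨fun w hw => (hf1 w hw).1.ne, hfA, ?_⟩, ?_, ?_⟩⟩
  · unfold parFuns
    rw [Fintype.mem_piFinset]
    intro w
    split_ifs with hw
    · exact hfA w hw
    · rw [hf2 w hw]; simp
  · intro w hw w' hw' h
    simp only [Sym2.eq_iff] at h
    rcases h with ⟨h, _⟩ | ⟨h1, h2⟩
    · exact h
    · have a1 := (hf1 w hw).2
      have a2 := (hf1 w' hw').2
      rw [h2] at a1
      rw [← h1] at a2
      omega
  · intro e he
    simp only [treeEdges, Finset.mem_filter, Finset.mem_univ, true_and] at he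
    obtain ⟨w, hw, h⟩ := he
    rw [← graphOf_adj]
    have a1 := (hf1 w hw).1
    simp only [Sym2.eq_iff] at h
    rcases h with ⟨h1, h2⟩ | ⟨h1, h2⟩
    · rw [h1, h2]; exact a1
    · rw [h1, h2]; exact a1.symm
  · intro e he
    simp only [cutEdges, Finset.mem_filter, Finset.mem_univ, true_and] at he
    by_contra hc
    have hc : ω e = true := by simpa using hc
    rw [← graphOf_adj] at hc
    apply he
    rw [hω', hω']
    exact ⟨fun h => h.trans hc.reachable, fun h => h.trans hc.symm.reachable⟩

lemma compEvent_prob {n : ℕ} {p : ℝ} (h0 : 0 ≤ p) (h1 : p ≤ 1) (A : Finset (Fin n)) (v : Fin n)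
    (hv : v ∈ A) :
    erProb n p (compEvent A v) ≤
      (A.card : ℝ) ^ (A.card - 1) * (p ^ (A.card - 1) * (1 - p) ^ (A.card * (n - A.card))) := by
  classical
  refine (erProb_union h0 h1 _ (parFuns A v) (parEvent A v) (compEvent_sub A v)).trans ?_
  refine (Finset.sum_le_card_nsmul _ _ _ fun f _ => parEvent_prob h0 h1 A v f).trans ?_
  rw [card_parFuns, Finset.card_erase_of_mem hv, nsmul_eq_mul]
  push_cast
  exact le_rfl

lemma size_prob {n : ℕ} {p : ℝ} (hn : 0 < n) (h0 : 0 ≤ p) (h1 : p ≤ 1) (k : ℕ) (hk : 0 < k) :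
    erProb n p {ω | maxCompSize (graphOf ω) = k} ≤
      (n.choose k : ℝ) * ((k : ℝ) ^ k * (p ^ (k - 1) * (1 - p) ^ (k * (n - k)))) := by
  classical
  have u1 : erProb n p {ω | maxCompSize (graphOf ω) = k} ≤
      ∑ A ∈ Finset.powersetCard k (Finset.univ : Finset (Fin n)),
        erProb n p {ω | ∃ v ∈ A, ω ∈ compEvent A v} := by
    apply erProb_union h0 h1
    intro ω hω
    have : Nonempty (Fin n) := ⟨⟨0, hn⟩⟩
    obtain ⟨v, _, hv⟩ := Finset.exists_mem_eq_sup (Finset.univ : Finset (Fin n))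
      Finset.univ_nonempty (fun v => {w | (graphOf ω).Reachable v w}.ncard)
    have hv' : {w | (graphOf ω).Reachable v w}.ncard = k := hv.symm.trans hω
    refine ⟨Finset.univ.filter fun w => (graphOf ω).Reachable v w, ?_, v, ?_, ?_⟩
    · rw [Finset.mem_powersetCard]
      refine ⟨Finset.subset_univ _, ?_⟩
      rw [← hv', ← Set.ncard_coe_finset]
      congr 1
      ext w; simp
    · simp
    · intro w; simp
  refine u1.trans ?_
  have u2 : ∀ A ∈ Finset.powersetCard k (Finset.univ : Finset (Fin n)),
      erProb n p {ω | ∃ v ∈ A, ω ∈ compEvent A v} ≤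
        (k : ℝ) ^ k * (p ^ (k - 1) * (1 - p) ^ (k * (n - k))) := by
    intro A hA
    have hc : A.card = k := (Finset.mem_powersetCard.1 hA).2
    refine (erProb_union h0 h1 _ A (compEvent A) fun ω hω => hω).trans ?_
    refine (Finset.sum_le_card_nsmul _ _ _ fun v hv => compEvent_prob h0 h1 A v hv).trans ?_
    rw [hc, nsmul_eq_mul, ← mul_assoc]
    apply le_of_eq
    congr 1
    obtain ⟨m, rfl⟩ := Nat.exists_eq_succ_of_ne_zero hk.ne'
    simp [pow_succ, mul_comm]
  refine (Finset.sum_le_card_nsmul _ _ _ u2).trans ?_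
  rw [Finset.card_powersetCard, Finset.card_univ, Fintype.card_fin, nsmul_eq_mul]

lemma size_prob' {n : ℕ} {p : ℝ} (hn : 0 < n) (h0 : 0 < p) (h1 : p ≤ 1) (k : ℕ) (hk : 0 < k)
    (hkn : k ≤ n) :
    erProb n p {ω | maxCompSize (graphOf ω) = k} ≤
      p⁻¹ * Real.exp (k * (1 + Real.log (n * p) - p * (n - k))) := by
  refine (size_prob hn h0.le h1 k hk).trans ?_
  have hnp : (0 : ℝ) < n * p := by positivity
  have e1 : (n.choose k : ℝ) * (k : ℝ) ^ k ≤ n ^ k * Real.exp k := by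
    have a1 := Nat.choose_le_pow_div (α := ℝ) k n
    have a2 := Real.pow_div_factorial_le_exp (k : ℝ) (by positivity) k
    calc (n.choose k : ℝ) * (k : ℝ) ^ k ≤ ((n : ℝ) ^ k / k.factorial) * (k : ℝ) ^ k := by gcongr
      _ = n ^ k * ((k : ℝ) ^ k / k.factorial) := by ring
      _ ≤ _ := by gcongr
  have e2 : (1 - p) ^ (k * (n - k)) ≤ Real.exp (-(p * (k * (n - k)))) := by
    have : 1 - p ≤ Real.exp (-p) := by linarith [Real.add_one_le_exp (-p)]
    calc (1 - p) ^ (k * (n - k)) ≤ Real.exp (-p) ^ (k * (n - k)) :=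
          pow_le_pow_left₀ (by linarith) this _
      _ = _ := by
          rw [← Real.exp_nat_mul]
          push_cast [Nat.cast_sub hkn]
          ring_nf
  have e3 : p ^ (k - 1) = p⁻¹ * p ^ k := by
    obtain ⟨m, rfl⟩ := Nat.exists_eq_succ_of_ne_zero hk.ne'
    rw [Nat.succ_sub_one, pow_succ]; field_simp
  have e4 : Real.exp (k * (1 + Real.log (n * p) - p * (n - k))) =
      Real.exp k * (n ^ k * p ^ k) * Real.exp (-(p * (k * (n - k)))) := by
    rw [← mul_pow, ← Real.exp_log (pow_pos hnp k), ← Real.exp_add, ← Real.exp_add, Real.log_pow]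
    congr 1
    ring
  have hq : 0 ≤ (1 - p) ^ (k * (n - k)) := pow_nonneg (by linarith) _
  calc (n.choose k : ℝ) * ((k : ℝ) ^ k * (p ^ (k - 1) * (1 - p) ^ (k * (n - k))))
      = ((n.choose k : ℝ) * (k : ℝ) ^ k) * (p ^ (k - 1) * (1 - p) ^ (k * (n - k))) := by ring
    _ ≤ (n ^ k * Real.exp k) * (p ^ (k - 1) * Real.exp (-(p * (k * (n - k))))) := by
        gcongr
    _ = _ := by rw [e3, e4]; ring

open Filter Asymptotics in
lemma analytic (a β₁ β₂ : ℝ) (ha0 : 0 < a) (hβ₁ : 0 < β₁) (hβ₂ : 0 < β₂) :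
    ∃ N : ℕ, ∀ n : ℕ, N ≤ n → 0 < n ∧ 1 ≤ Real.log n ∧ 1 ≤ a * Real.log n ∧
      0 < Real.log (Real.log n) ∧
      1 + Real.log (Real.log n) ≤ a * Real.log n / 4 ∧
      2 * Real.log (Real.log n) + Real.log (Real.log n) ^ 2 ≤ a * β₂ * Real.log n ∧
      a * β₁ / 4 * Real.log n ^ 2 ≤ n / 2 ∧
      3 * Real.log n ≤ a * β₁ / 8 * Real.log n ^ 2 := by
  have hL : Tendsto (fun n : ℕ => Real.log n) atTop atTop :=
    Real.tendsto_log_atTop.comp tendsto_natCast_atTop_atTop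
  have l1 : ∀ c : ℝ, 0 < c → ∀ᶠ x : ℝ in atTop, Real.log x ≤ c * x := by
    intro c hc
    have := (Real.isLittleO_pow_log_id_atTop (n := 1)).def hc
    filter_upwards [this, eventually_ge_atTop 0] with x hx hx0
    simp only [pow_one, id, Real.norm_eq_abs, abs_of_nonneg hx0] at hx
    exact (le_abs_self _).trans hx
  have l2 : ∀ c : ℝ, 0 < c → ∀ᶠ x : ℝ in atTop, Real.log x ^ 2 ≤ c * x := by
    intro c hc
    have := (Real.isLittleO_pow_log_id_atTop (n := 2)).def hc
    filter_upwards [this, eventually_ge_atTop 0] with x hx hx0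
    simp only [id, Real.norm_eq_abs, abs_of_nonneg hx0] at hx
    exact (le_abs_self _).trans hx
  have hab : 0 < a * β₁ := by positivity
  have hab2 : 0 < a * β₂ := by positivity
  have E := (eventually_gt_atTop 0).and ((hL.eventually (eventually_ge_atTop (8 / a))).and
    ((hL.eventually (eventually_gt_atTop 1)).and
    ((hL.eventually (eventually_ge_atTop (24 / (a * β₁)))).and
    ((hL.eventually (l1 (a / 8) (by positivity))).and
    ((hL.eventually (l1 (a * β₂ / 4) (by positivity))).and
    ((hL.eventually (l2 (a * β₂ / 2) (by positivity))).and
    (tendsto_natCast_atTop_atTop.eventually (l2 (2 / (a * β₁)) (by positivity)))))))))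
  obtain ⟨N, hN⟩ := eventually_atTop.1 E
  refine ⟨N, fun n hn => ?_⟩
  obtain ⟨h1, h2, h3, h4, h5, h6, h7, h8⟩ := hN n hn
  rw [div_le_iff₀ ha0] at h2
  rw [div_le_iff₀ hab] at h4
  refine ⟨h1, h3.le, by linarith, Real.log_pos h3, by linarith, by linarith, ?_, ?_⟩
  · have := mul_le_mul_of_nonneg_left h8 (show 0 ≤ a * β₁ / 4 by positivity)
    refine this.trans (le_of_eq ?_)
    field_simp
    norm_num
  · nlinarith

lemma maxComp_le {n : ℕ} (H : SimpleGraph (Fin n)) : maxCompSize H ≤ n := by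
  unfold maxCompSize
  refine Finset.sup_le fun v _ => ?_
  refine (Set.ncard_le_ncard (Set.subset_univ _)).trans ?_
  simp

/-- For `0 < a < 1`, `p_n = a·log n/n` and constants `β₁, β₂ > 0`,
there are `C > 0` and `N` such that for all `n ≥ N` the largest connected component
of `G(n, p_n)` has size in `[β₁ log n, n − β₂ n / log log n]` with probability at
most `n^(−C·log n)`. -/
theorem er_no_medium_component (a β₁ β₂ : ℝ) (ha0 : 0 < a) (ha1 : a < 1)
    (hβ₁ : 0 < β₁) (hβ₂ : 0 < β₂) :
    ∃ C : ℝ, 0 < C ∧ ∃ N : ℕ, ∀ n : ℕ, N ≤ n →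
      erProb n (a * Real.log n / n)
          {ω | β₁ * Real.log n ≤ (maxCompSize (graphOf ω) : ℝ) ∧
               (maxCompSize (graphOf ω) : ℝ) ≤ n - β₂ * n / Real.log (Real.log n)}
        ≤ (n : ℝ) ^ (-(C * Real.log n)) := by
  obtain ⟨N, hN⟩ := analytic a β₁ β₂ ha0 hβ₁ hβ₂
  refine ⟨a * β₁ / 8, by positivity, N, fun n hn => ?_⟩
  obtain ⟨hn0, hL1, haL, hll, h4, h5, h6, h7⟩ := hN n hn
  have hnR : (0 : ℝ) < n := by exact_mod_cast hn0
  set L := Real.log n with hLdef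
  set l := Real.log L with hldef
  set p := a * L / n with hp
  have hLn : L ≤ n := (Real.log_le_sub_one_of_pos hnR).trans (by linarith)
  have hp0 : 0 < p := by positivity
  have hp1 : p ≤ 1 := by
    rw [hp, div_le_one hnR]; nlinarith
  have hnp : (n : ℝ) * p = a * L := by rw [hp]; field_simp
  have hpinv : p⁻¹ ≤ Real.exp L := by
    rw [hLdef, Real.exp_log hnR, hp, inv_div, div_le_iff₀ (by linarith)]
    nlinarith
  have hlog : Real.log (n * p) ≤ l := by
    rw [hnp]
    apply Real.log_le_log (by positivity)
    nlinarith
  classical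
  let K : Finset ℕ := (Finset.range (n + 1)).filter fun k =>
    β₁ * L ≤ (k : ℝ) ∧ (k : ℝ) ≤ n - β₂ * n / l
  have hU := erProb_union hp0.le hp1
    {ω : EConfig n | β₁ * L ≤ (maxCompSize (graphOf ω) : ℝ) ∧
               (maxCompSize (graphOf ω) : ℝ) ≤ n - β₂ * n / l} K
    (fun k => {ω | maxCompSize (graphOf ω) = k}) (by
      intro ω hω
      refine ⟨maxCompSize (graphOf ω), ?_, rfl⟩
      simp only [K, Finset.mem_filter, Finset.mem_range]
      exact ⟨Nat.lt_succ_of_le (maxComp_le _), hω.1, hω.2⟩)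
  refine hU.trans ?_
  have hk : ∀ k ∈ K, erProb n p {ω : EConfig n | maxCompSize (graphOf ω) = k} ≤
      Real.exp (L - a * β₁ / 4 * L ^ 2) := by
    intro k hk
    simp only [K, Finset.mem_filter, Finset.mem_range] at hk
    obtain ⟨k1, k2, k3⟩ := hk
    have hkpos : (0 : ℝ) < k := lt_of_lt_of_le (by positivity) k2
    have hkpos' : 0 < k := by exact_mod_cast hkpos
    refine (size_prob' hn0 hp0 hp1 k hkpos' (by omega)).trans ?_
    have hexp : (k : ℝ) * (1 + Real.log (n * p) - p * (n - k)) ≤ -(a * β₁ / 4 * L ^ 2) := by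
      have hstep : (k : ℝ) * (1 + Real.log (n * p) - p * (n - k)) ≤
          k * (1 + l - p * (n - k)) := by gcongr
      refine hstep.trans ?_
      rcases le_total (k : ℝ) (n / 2) with hc | hc
      · have q1 : a * L / 2 ≤ p * (n - k) := by
          have : p * (n / 2) ≤ p * (n - k) := mul_le_mul_of_nonneg_left (by linarith) hp0.le
          linarith
        have q2 : 1 + l - p * (n - k) ≤ -(a * L / 4) := by linarith
        have q3 := mul_le_mul_of_nonneg_left q2 hkpos.le
        have q4 := mul_le_mul_of_nonneg_right k2 (show 0 ≤ a * L / 4 by positivity)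
        linarith
      · have q1 : a * β₂ * L / l ≤ p * (n - k) := by
          have : p * (β₂ * n / l) ≤ p * (n - k) := mul_le_mul_of_nonneg_left (by linarith) hp0.le
          refine le_trans (le_of_eq ?_) this
          rw [hp]; field_simp
        have q2 : 2 + l ≤ a * β₂ * L / l := by
          rw [le_div_iff₀ hll]; linarith
        have q3 := mul_le_mul_of_nonneg_left
          (show 1 + l - p * (n - k) ≤ -1 by linarith) hkpos.le
        linarith
    calc p⁻¹ * Real.exp (k * (1 + Real.log (n * p) - p * (n - k)))
        ≤ Real.exp L * Real.exp (-(a * β₁ / 4 * L ^ 2)) := by gcongr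
      _ = _ := by rw [← Real.exp_add]; ring_nf
  refine (Finset.sum_le_card_nsmul _ _ _ hk).trans ?_
  have hK : (K.card : ℝ) ≤ Real.exp (2 * L) := by
    have c1 : K.card ≤ n + 1 := (Finset.card_filter_le _ _).trans (by simp)
    have c2 : (K.card : ℝ) ≤ n + 1 := by exact_mod_cast c1
    have c3 : Real.exp (2 * L) = (n : ℝ) * n := by
      rw [two_mul, Real.exp_add, hLdef, Real.exp_log hnR]
    have c4 : (2 : ℝ) ≤ n := by
      have := Real.add_one_le_exp L
      rw [hLdef, Real.exp_log hnR, ← hLdef] at this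
      linarith
    nlinarith
  rw [nsmul_eq_mul, Real.rpow_def_of_pos hnR, ← hLdef]
  calc (K.card : ℝ) * Real.exp (L - a * β₁ / 4 * L ^ 2)
      ≤ Real.exp (2 * L) * Real.exp (L - a * β₁ / 4 * L ^ 2) := by gcongr
    _ = Real.exp (3 * L - a * β₁ / 4 * L ^ 2) := by rw [← Real.exp_add]; ring_nf
    _ ≤ _ := by
      apply Real.exp_le_exp.2
      nlinarith

end ErdosRenyi
end

section
/- Let 𝒢 be a finite group of order M ≥ 1 with identity I, and let A and B be disjoint finite vertex sets with Δ = |B|. Consider a simple graph on A ∪ B whose induced subgraph on A is connected, whose edges internal to A and internal to B all carry the label I, and whose r edges between A and B carry labels drawn independently and uniformly at random from 𝒢. Then the probability that there exists an assignment g : A ∪ B → 𝒢 satisfying g_{ij} = g_i·g_j⁻¹ for every edge {i,j} of the graph (where g_{ij} denotes the label on the edge oriented from i to j, with g_{ji} = g_{ij}⁻¹) is at most min{1, M^{Δ − r}}. -/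
/-!
Cycle-consistency lemma (Lemma 1 of the paper): on a graph over `A ∪ B` whose
induced subgraph on `A` is connected, whose internal edges carry the identity
label and whose `r` cross edges carry i.i.d. uniform labels from a group of order
`M`, the probability that a globally consistent assignment exists is at most
`min {1, M^(Δ − r)}` where `Δ = |B|`.

The `r` cross-edge labels are uniform and independent, so the sample space is the
set of functions from the cross edges to the group (of cardinality `M^r`) with the
uniform distribution; the probability of an event is its cardinality divided by
`M^r`.
-/

theorem cycle_consistency_bound
    (V : Type) [Fintype V] [DecidableEq V]
    (G : Type) [Group G] [Fintype G] [DecidableEq G]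
    (M : ℕ) (hM : 1 ≤ M) (hcard : Fintype.card G = M)
    (A B : Finset V) (hdisj : Disjoint A B) (hcover : A ∪ B = Finset.univ)
    (H : SimpleGraph V)
    (hconn : (H.induce (A : Set V)).Connected)
    (Δ : ℕ) (hΔ : Δ = B.card)
    (cross : Finset (V × V))
    (hcross : ∀ e : V × V, e ∈ cross ↔ H.Adj e.1 e.2 ∧ e.1 ∈ A ∧ e.2 ∈ B)
    (r : ℕ) (hr : r = cross.card) :
    ((Nat.card {ω : {e : V × V // e ∈ cross} → G //
        ∃ g : V → G,
          (∀ i j, H.Adj i j → ((i ∈ A ∧ j ∈ A) ∨ (i ∈ B ∧ j ∈ B)) → g i = g j) ∧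
          (∀ e : {e : V × V // e ∈ cross}, ω e = g e.val.1 * (g e.val.2)⁻¹)} : ℝ)
        / (M : ℝ) ^ r)
      ≤ min 1 ((M : ℝ) ^ ((Δ : ℤ) - (r : ℤ))) := by
  classical
  have hMpos : (0 : ℝ) < (M : ℝ) := by exact_mod_cast hM
  set P : ({e : V × V // e ∈ cross} → G) → Prop := fun ω =>
    ∃ g : V → G,
      (∀ i j, H.Adj i j → ((i ∈ A ∧ j ∈ A) ∨ (i ∈ B ∧ j ∈ B)) → g i = g j) ∧
      (∀ e : {e : V × V // e ∈ cross}, ω e = g e.val.1 * (g e.val.2)⁻¹) with hP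
  change ((Nat.card {ω // P ω} : ℝ) / (M : ℝ) ^ r) ≤ _
  -- trivial bound
  have h1 : Nat.card {ω // P ω} ≤ M ^ r := by
    have h := Nat.card_le_card_of_injective (Subtype.val : {ω // P ω} → _)
      Subtype.val_injective
    simpa [Nat.card_eq_fintype_card, hcard, hr] using h
  -- consistent labelings are determined by a function on `B`
  have h2 : Nat.card {ω // P ω} ≤ M ^ Δ := by
    obtain ⟨a₀⟩ := hconn.nonempty
    have key : ∀ ω : {ω // P ω}, ∃ f : {b : V // b ∈ B} → G,
        ∀ e : {e : V × V // e ∈ cross}, ω.1 e = f ⟨e.1.2, ((hcross e.1).1 e.2).2.2⟩ := by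
      rintro ⟨ω, g, hg, hω⟩
      have hwalk : ∀ x y : (A : Set V), (H.induce (A : Set V)).Walk x y → g x = g y := by
        intro x y w
        induction w with
        | nil => rfl
        | @cons u v w h p ih =>
          exact (hg u v h (Or.inl ⟨u.2, v.2⟩)).trans ih
      refine ⟨fun b => g a₀ * (g b)⁻¹, fun e => ?_⟩
      have hA : e.1.1 ∈ A := ((hcross e.1).1 e.2).2.1
      obtain ⟨w⟩ := hconn.preconnected ⟨e.1.1, hA⟩ a₀
      have := hwalk _ _ w
      simp only at this ⊢
      rw [hω e, this]
    choose f hf using key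
    have hinj : Function.Injective f := by
      intro ω₁ ω₂ h
      apply Subtype.ext
      funext e
      rw [hf ω₁ e, hf ω₂ e, h]
    have h := Nat.card_le_card_of_injective f hinj
    simpa [Nat.card_eq_fintype_card, hcard, hΔ] using h
  refine le_min ?_ ?_
  · rw [div_le_one (by positivity)]
    exact_mod_cast h1
  · rw [zpow_sub₀ hMpos.ne', zpow_natCast, zpow_natCast]
    gcongr
    exact_mod_cast h2
end

section
/- Let M ≥ 1 be an integer and a, b > 0 constants. For even n set p = a·log n/n, q = b·log n/n, δ_n = ⌈log n / log log n⌉, and let X_n and Y_n be independent with X_n ~ Binomial(n/2 − ⌈n/(log n)³⌉, p) and Y_n ~ Binomial(n/2, q). Then for every ε > 0 there is N such that for all even n ≥ N: log E[𝟙{Y_n ≥ X_n + δ_n} · M^{−Y_n}] ≥ (−(a+b)/2 + √(ab/M) − ε) · log n. -/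
/-!
Lemma 4 of the paper: a lower bound on `log E[𝟙{Y ≥ X + δ} · M^(−Y)]` for
independent binomials `X ~ Binom(n/2 − ⌈n/(log n)³⌉, p)` and `Y ~ Binom(n/2, q)`
with `p = a log n / n`, `q = b log n / n` and `δ = ⌈log n / log log n⌉`.
-/

open scoped BigOperators

/-- The binomial probability mass function with `N` trials and success
probability `p`. -/
noncomputable def binomPMF (N : ℕ) (p : ℝ) (k : ℕ) : ℝ :=
  (N.choose k : ℝ) * p ^ k * (1 - p) ^ (N - k)

open Filter Topology in
lemma aux_factorial (j : ℕ) :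
    Real.log (j.factorial : ℝ) ≤ ((j : ℝ) + 1) * Real.log ((j : ℝ) + 1) - j := by
  induction j with
  | zero => simp
  | succ j ih =>
    have hm : (0 : ℝ) < (j : ℝ) + 1 := by positivity
    have hm2 : (0 : ℝ) < (j : ℝ) + 1 + 1 := by positivity
    rw [Nat.factorial_succ]
    push_cast
    rw [Real.log_mul (by positivity) (by positivity)]
    have h := Real.one_sub_inv_le_log_of_pos (x := ((j : ℝ) + 1 + 1) / ((j : ℝ) + 1)) (by positivity)
    rw [Real.log_div (by positivity) (by positivity)] at h
    have h2 : 1 - (((j : ℝ) + 1 + 1) / ((j : ℝ) + 1))⁻¹ = 1 / ((j : ℝ) + 1 + 1) := by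
      field_simp
      ring
    rw [h2, div_le_iff₀ hm2] at h
    nlinarith

lemma aux_binom_pos (N k : ℕ) (p : ℝ) (hk : k < N) (hp : 0 < p) (hp1 : p < 1) :
    0 < binomPMF N p k := by
  unfold binomPMF
  have := Nat.choose_pos hk.le
  have h1 : 0 < 1 - p := by linarith
  positivity

lemma aux_binom_nonneg (N k : ℕ) (p : ℝ) (hp : 0 < p) (hp1 : p < 1) :
    0 ≤ binomPMF N p k := by
  unfold binomPMF
  have h1 : 0 < 1 - p := by linarith
  positivity

lemma aux_binom (N k : ℕ) (p : ℝ) (hk : k < N) (hp : 0 < p) (hp1 : p < 1) :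
    k * Real.log (((N : ℝ) - k) * p) - (((k : ℝ) + 1) * Real.log ((k : ℝ) + 1) - k)
      - N * p / (1 - p) ≤ Real.log (binomPMF N p k) := by
  have h1 : 0 < 1 - p := by linarith
  have hkN : (k : ℝ) < N := by exact_mod_cast hk
  have hNk : 0 < (N : ℝ) - k := by linarith
  have hc : (0 : ℝ) < (N.choose k : ℝ) := by exact_mod_cast Nat.choose_pos hk.le
  have hf : (0 : ℝ) < (k.factorial : ℝ) := by positivity
  have e1 : ((N : ℝ) - k) ^ k ≤ (N.choose k : ℝ) * k.factorial := by
    have h := Nat.pow_sub_le_descFactorial N k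
    rw [Nat.descFactorial_eq_factorial_mul_choose] at h
    have h' : (((N + 1 - k : ℕ) : ℝ)) ^ k ≤ (k.factorial : ℝ) * (N.choose k : ℝ) := by
      exact_mod_cast h
    rw [Nat.cast_sub (by omega)] at h'
    push_cast at h'
    calc ((N : ℝ) - k) ^ k ≤ ((N : ℝ) + 1 - k) ^ k :=
          pow_le_pow_left₀ hNk.le (by linarith) k
      _ ≤ _ := by linarith
  have e2 := Real.log_le_log (by positivity) e1
  rw [Real.log_mul hc.ne' hf.ne', Real.log_pow] at e2
  have e3 := aux_factorial k
  have e4 : - (N * p / (1 - p)) ≤ ((N - k : ℕ) : ℝ) * Real.log (1 - p) := by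
    have h := Real.one_sub_inv_le_log_of_pos h1
    have hn : Real.log (1 - p) ≤ 0 := Real.log_nonpos h1.le (by linarith)
    have h3 : 1 - (1 - p)⁻¹ = - (p / (1 - p)) := by
      field_simp
      ring
    rw [h3] at h
    have h4 : ((N - k : ℕ) : ℝ) ≤ N := by exact_mod_cast Nat.sub_le N k
    have h5 : (N : ℝ) * (-(p / (1 - p))) ≤ N * Real.log (1 - p) :=
      mul_le_mul_of_nonneg_left h (by positivity)
    have h6 : (N : ℝ) * Real.log (1 - p) ≤ ((N - k : ℕ) : ℝ) * Real.log (1 - p) :=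
      mul_le_mul_of_nonpos_right h4 hn
    have h7 : (N : ℝ) * (-(p / (1 - p))) = - (N * p / (1 - p)) := by ring
    linarith
  unfold binomPMF
  rw [Real.log_mul hNk.ne' hp.ne', Real.log_mul (by positivity) (pow_pos h1 _).ne',
    Real.log_mul hc.ne' (pow_pos hp _).ne', Real.log_pow, Real.log_pow]
  linarith

open Filter Topology in
lemma aux_L : Tendsto (fun n : ℕ => Real.log (n : ℝ)) atTop atTop :=
  Real.tendsto_log_atTop.comp tendsto_natCast_atTop_atTop

open Filter Topology in
lemma aux_Ln : Tendsto (fun n : ℕ => Real.log (n : ℝ) / n) atTop (𝓝 0) :=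
  (Real.isLittleO_log_id_atTop.tendsto_div_nhds_zero).comp tendsto_natCast_atTop_atTop

open Filter Topology in
lemma aux_LL : Tendsto (fun n : ℕ => Real.log (Real.log (n : ℝ)) / Real.log n) atTop (𝓝 0) :=
  (Real.isLittleO_log_id_atTop.tendsto_div_nhds_zero).comp aux_L

open Filter Topology in
lemma aux_p (c : ℝ) (hc : 0 < c) :
    ∀ᶠ n : ℕ in atTop, 0 < c * Real.log n / n ∧ c * Real.log n / n < 1 := by
  have h : Tendsto (fun n : ℕ => c * Real.log (n : ℝ) / n) atTop (𝓝 0) := by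
    have := aux_Ln.const_mul c
    simpa [mul_div_assoc] using this
  filter_upwards [h.eventually_lt_const one_pos, aux_L.eventually_gt_atTop 0,
    eventually_gt_atTop 0] with n h1 h2 h3
  exact ⟨by positivity, h1⟩

open Filter Topology in
lemma aux_lt (N k : ℕ → ℕ) (s : ℝ)
    (hN : Tendsto (fun n => (N n : ℝ) / n) atTop (𝓝 (1 / 2)))
    (hk : Tendsto (fun n => (k n : ℝ) / Real.log n) atTop (𝓝 s)) :
    Tendsto (fun n => ((N n : ℝ) - k n) / n) atTop (𝓝 (1 / 2)) ∧
    ∀ᶠ n in atTop, k n < N n := by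
  have h1 : Tendsto (fun n => ((N n : ℝ) - k n) / n) atTop (𝓝 (1 / 2)) := by
    have := hN.sub (hk.mul aux_Ln)
    simp only [mul_zero, sub_zero] at this
    refine this.congr' ?_
    filter_upwards [aux_L.eventually_gt_atTop 0, eventually_gt_atTop 0] with n h2 h3
    have h2' := h2.ne'
    field_simp
  refine ⟨h1, ?_⟩
  filter_upwards [h1.eventually_const_lt (show (0 : ℝ) < 1 / 2 by norm_num),
    eventually_gt_atTop 0] with n h2 h3
  have h3' : (0 : ℝ) < n := by exact_mod_cast h3
  have := (div_pos_iff_of_pos_right h3').1 h2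
  have h4 : (k n : ℝ) < N n := by linarith
  exact_mod_cast h4

open Filter Topology in
lemma aux_main (N k : ℕ → ℕ) (s c : ℝ) (hs : 0 < s) (hc : 0 < c)
    (hN : Tendsto (fun n => (N n : ℝ) / n) atTop (𝓝 (1 / 2)))
    (hk : Tendsto (fun n => (k n : ℝ) / Real.log n) atTop (𝓝 s)) (ε : ℝ) (hε : 0 < ε) :
    ∀ᶠ n : ℕ in atTop, (-c / 2 + s * (1 + Real.log (c / 2) - Real.log s) - ε) * Real.log n ≤
      Real.log (binomPMF (N n) (c * Real.log n / n) (k n)) := by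
  obtain ⟨hd, hlt⟩ := aux_lt N k s hN hk
  have hp0 : Tendsto (fun n : ℕ => c * Real.log (n : ℝ) / n) atTop (𝓝 0) := by
    have := aux_Ln.const_mul c
    simpa [mul_div_assoc] using this
  have hk1 : Tendsto (fun n => ((k n : ℝ) + 1) / Real.log n) atTop (𝓝 s) := by
    have := hk.add aux_L.inv_tendsto_atTop
    simp only [add_zero] at this
    refine this.congr fun n => ?_
    simp [add_div]
  have hlk := hk1.log hs.ne'
  have hld := (hd.mul_const c).log (by positivity)
  have hlk0 : Tendsto (fun n : ℕ => Real.log (((k n : ℝ) + 1) / Real.log n) * (Real.log n)⁻¹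
      + Real.log (Real.log n) / Real.log n) atTop (𝓝 0) := by
    have := (hlk.mul aux_L.inv_tendsto_atTop).add aux_LL
    simpa using this
  have hG := ((hk.mul ((hld.sub hlk).add_const 1)).sub hlk0).sub
    ((hN.mul_const c).div (hp0.const_sub 1) (by norm_num))
  have hG' := hG.eventually_const_lt
    (show -c / 2 + s * (1 + Real.log (c / 2) - Real.log s) - ε < _ by
      rw [show (1 : ℝ) / 2 * c = c / 2 by ring]
      simp only [sub_zero, div_one]
      linarith)
  filter_upwards [hG', hlt, aux_p c hc, aux_L.eventually_gt_atTop 0,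
    eventually_gt_atTop 0] with n h1 h2 h3 h4 h5
  refine le_trans ?_ (aux_binom (N n) (k n) _ h2 h3.1 h3.2)
  have hn : (0 : ℝ) < n := by exact_mod_cast h5
  have hkN : 0 < (N n : ℝ) - k n := by
    have : (k n : ℝ) < N n := by exact_mod_cast h2
    linarith
  have h6 := mul_le_mul_of_nonneg_right h1.le h4.le
  refine h6.trans (le_of_eq ?_)
  have hq : 1 - c * Real.log n / n ≠ 0 := by linarith [h3.2]
  have e1 : Real.log (((N n : ℝ) - k n) * (c * Real.log n / n)) =
      Real.log (((N n : ℝ) - k n) / n * c) + Real.log (Real.log n) := by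
    rw [← Real.log_mul (by positivity) h4.ne']
    congr 1
    ring
  rw [e1, Real.log_div (by positivity) h4.ne']
  generalize Real.log (((N n : ℝ) - k n) / n * c) = A
  generalize Real.log (Real.log (n : ℝ)) = B
  generalize Real.log ((k n : ℝ) + 1) = C
  have h4' := h4.ne'
  have e2 : (N n : ℝ) * (c * Real.log n / n) / (1 - c * Real.log n / n) =
    ((N n : ℝ) / n * c / (1 - c * Real.log n / n)) * Real.log n := by ring
  simp only [Pi.div_apply] at *
  rw [e2]
  generalize ((N n : ℝ) / n * c / (1 - c * Real.log n / n)) = D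
  field_simp
  ring

open Filter Topology in
lemma aux_half : Tendsto (fun n : ℕ => ((n / 2 : ℕ) : ℝ) / n) atTop (𝓝 (1 / 2)) := by
  have h := (tendsto_nat_floor_mul_div_atTop (R := ℝ) (a := 1 / 2) (by norm_num)).comp
    (tendsto_natCast_atTop_atTop (R := ℝ))
  refine h.congr fun n => ?_
  simp only [Function.comp]
  congr 2
  rw [show (1 / 2 : ℝ) * n = (n : ℝ) / (2 : ℕ) by push_cast; ring, Nat.floor_div_natCast,
    Nat.floor_natCast]

open Filter Topology in
lemma aux_ceil (f g : ℕ → ℝ) (l : ℝ) (hf : ∀ᶠ n in atTop, 0 ≤ f n)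
    (hg : Tendsto g atTop atTop) (h : Tendsto (fun n => f n / g n) atTop (𝓝 l)) :
    Tendsto (fun n => (⌈f n⌉₊ : ℝ) / g n) atTop (𝓝 l) := by
  have h2 := h.add hg.inv_tendsto_atTop
  rw [add_zero] at h2
  refine tendsto_of_tendsto_of_tendsto_of_le_of_le' h h2 ?_ ?_
  · filter_upwards [hg.eventually_gt_atTop 0] with n hn
    exact div_le_div_of_nonneg_right (Nat.le_ceil _) hn.le
  · filter_upwards [hg.eventually_gt_atTop 0, hf] with n hn h0
    have := (Nat.ceil_lt_add_one h0).le
    calc (⌈f n⌉₊ : ℝ) / g n ≤ (f n + 1) / g n := div_le_div_of_nonneg_right this hn.le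
      _ = _ := by simp [add_div]

open Filter Topology in
lemma aux_N1 : Tendsto (fun n : ℕ =>
    ((n / 2 - ⌈(n : ℝ) / (Real.log n) ^ 3⌉₊ : ℕ) : ℝ) / n) atTop (𝓝 (1 / 2)) := by
  have h1 : Tendsto (fun n : ℕ => (⌈(n : ℝ) / (Real.log n) ^ 3⌉₊ : ℝ) / n) atTop (𝓝 0) := by
    refine aux_ceil _ _ _ ?_ tendsto_natCast_atTop_atTop ?_
    · filter_upwards [aux_L.eventually_gt_atTop 0] with n hn
      positivity
    · have h := (tendsto_pow_atTop (α := ℝ) (n := 3) (by norm_num)).comp aux_L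
      refine h.inv_tendsto_atTop.congr' ?_
      filter_upwards [eventually_gt_atTop 0, aux_L.eventually_gt_atTop 0] with n hn h5
      have h5' := h5.ne'
      simp only [Pi.inv_apply, Function.comp]
      field_simp
  have h2 := aux_half.sub h1
  rw [sub_zero] at h2
  refine h2.congr' ?_
  filter_upwards [h2.eventually_const_lt (show (0 : ℝ) < 1 / 2 by norm_num),
    eventually_gt_atTop 0] with n h3 h4
  have h4' : (0 : ℝ) < n := by exact_mod_cast h4
  rw [← sub_div] at h3 ⊢
  have := (div_pos_iff_of_pos_right h4').1 h3
  rw [Nat.cast_sub]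
  have h6 : (⌈(n : ℝ) / (Real.log n) ^ 3⌉₊ : ℝ) ≤ ((n / 2 : ℕ) : ℝ) := by linarith
  exact_mod_cast h6

open Filter Topology in
lemma aux_delta : Tendsto (fun n : ℕ =>
    (⌈Real.log n / Real.log (Real.log n)⌉₊ : ℝ) / Real.log n) atTop (𝓝 0) := by
  have hLL := Real.tendsto_log_atTop.comp aux_L
  refine aux_ceil _ _ _ ?_ aux_L ?_
  · filter_upwards [aux_L.eventually_gt_atTop 0, hLL.eventually_gt_atTop 0] with n hn h2
    exact div_nonneg hn.le h2.le
  · refine hLL.inv_tendsto_atTop.congr' ?_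
    filter_upwards [aux_L.eventually_gt_atTop 0, hLL.eventually_gt_atTop 0] with n hn h2
    have h3 := hn.ne'
    have h4 := h2.ne'
    simp only [Pi.inv_apply, Function.comp] at *
    field_simp

/-- For every `ε > 0` and all large even `n`,
`log E[𝟙{Y_n ≥ X_n + δ_n} · M^(−Y_n)] ≥ (−(a+b)/2 + √(ab/M) − ε) · log n`,
the expectation being the explicit double sum over the joint law of the
independent pair `(X_n, Y_n)`. -/
theorem log_expectation_lower_bound
    (M : ℕ) (hM : 1 ≤ M) (a b : ℝ) (ha : 0 < a) (hb : 0 < b) :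
    ∀ ε : ℝ, 0 < ε → ∃ N : ℕ, ∀ n : ℕ, N ≤ n → Even n →
      (-(a + b) / 2 + Real.sqrt (a * b / M) - ε) * Real.log n ≤
        Real.log
          (∑ j ∈ Finset.range (n / 2 - ⌈(n : ℝ) / (Real.log n) ^ 3⌉₊ + 1),
            ∑ k ∈ Finset.range (n / 2 + 1),
              binomPMF (n / 2 - ⌈(n : ℝ) / (Real.log n) ^ 3⌉₊)
                  (a * Real.log n / n) j *
                binomPMF (n / 2) (b * Real.log n / n) k *
                (if j + ⌈Real.log n / Real.log (Real.log n)⌉₊ ≤ k then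
                  (M : ℝ) ^ (-(k : ℤ)) else 0)) := by
  intro ε hε
  have hM0 : (0 : ℝ) < M := by exact_mod_cast hM
  obtain ⟨s, hs⟩ : ∃ s : ℝ, s = Real.sqrt (a * b / M) / 2 := ⟨_, rfl⟩
  have hs0 : 0 < s := by rw [hs]; positivity
  have hss : 4 * s ^ 2 * M = a * b := by
    rw [hs, div_pow, Real.sq_sqrt (by positivity)]
    field_simp
    norm_num
  have hj : Filter.Tendsto (fun n : ℕ => (⌈s * Real.log n⌉₊ : ℝ) / Real.log n) Filter.atTop (nhds s) := by
    refine aux_ceil _ _ _ ?_ aux_L ?_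
    · filter_upwards [aux_L.eventually_gt_atTop 0] with n hn
      positivity
    · refine (tendsto_const_nhds (x := s)).congr' ?_
      filter_upwards [aux_L.eventually_gt_atTop 0] with n hn
      have := hn.ne'
      field_simp
  have hk : Filter.Tendsto (fun n : ℕ => ((⌈s * Real.log n⌉₊ +
      ⌈Real.log n / Real.log (Real.log n)⌉₊ : ℕ) : ℝ) / Real.log n) Filter.atTop (nhds s) := by
    have := hj.add aux_delta
    rw [add_zero] at this
    refine this.congr fun n => ?_
    push_cast
    ring
  have hX := aux_main _ _ s a hs0 ha aux_N1 hj (ε / 3) (by positivity)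
  have hY := aux_main _ _ s b hs0 hb aux_half hk (ε / 3) (by positivity)
  have hZ := (hk.mul_const (Real.log M)).eventually_lt_const
    (show s * Real.log M < s * Real.log M + ε / 3 by linarith)
  have key : 2 + Real.log (a / 2) - Real.log s + Real.log (b / 2) - Real.log s - Real.log M
      = 2 := by
    have h := congrArg Real.log hss
    rw [Real.log_mul (by positivity) (by positivity), Real.log_mul (by positivity) (by positivity),
      Real.log_mul (by positivity) (by positivity), Real.log_pow,
      show (4 : ℝ) = 2 * 2 by norm_num, Real.log_mul (by norm_num) (by norm_num)] at h
    rw [Real.log_div (by positivity) (by positivity), Real.log_div (by positivity) (by positivity)]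
    push_cast at h
    linarith
  have hall := (((hX.and hY).and hZ).and ((aux_p a ha).and (aux_p b hb))).and
    (((aux_lt _ _ s aux_N1 hj).2.and (aux_lt _ _ s aux_half hk).2).and
      (aux_L.eventually_gt_atTop 0))
  obtain ⟨N0, hN0⟩ := Filter.eventually_atTop.1 hall
  refine ⟨N0, fun n hn _ => ?_⟩
  obtain ⟨⟨⟨⟨hX, hY⟩, hZ⟩, hpa, hpb⟩, ⟨hlt1, hlt2⟩, hL⟩ := hN0 n hn
  have hP1 := aux_binom_pos _ _ _ hlt1 hpa.1 hpa.2
  have hP2 := aux_binom_pos _ _ _ hlt2 hpb.1 hpb.2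
  generalize n / 2 - ⌈(n : ℝ) / (Real.log n) ^ 3⌉₊ = N1 at *
  generalize ⌈Real.log n / Real.log (Real.log n)⌉₊ = d at *
  generalize ⌈s * Real.log n⌉₊ = j at *
  have hterm : binomPMF N1 (a * Real.log n / n) j * binomPMF (n / 2) (b * Real.log n / n) (j + d)
      * (M : ℝ) ^ (-((j + d : ℕ) : ℤ)) ≤ _ := le_trans (le_of_eq ?_)
    (le_trans (Finset.single_le_sum (f := fun k => binomPMF N1 (a * Real.log n / n) j *
      binomPMF (n / 2) (b * Real.log n / n) k *
                (if j + d ≤ k then (M : ℝ) ^ (-(k : ℤ)) else 0)) (s := Finset.range (n / 2 + 1))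
      ?_ (Finset.mem_range.2 (show j + d < n / 2 + 1 by omega)))
    (Finset.single_le_sum (f := fun j => ∑ k ∈ Finset.range (n / 2 + 1),
      binomPMF N1 (a * Real.log n / n) j *
      binomPMF (n / 2) (b * Real.log n / n) k *
                (if j + d ≤ k then (M : ℝ) ^ (-(k : ℤ)) else 0)) (s := Finset.range (N1 + 1))
      ?_ (Finset.mem_range.2 (show j < N1 + 1 by omega))))
  · refine le_trans ?_ (Real.log_le_log (by positivity) hterm)
    rw [Real.log_mul (by positivity) (by positivity), Real.log_mul hP1.ne' hP2.ne',
      Real.log_zpow]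
    have hZ' := mul_le_mul_of_nonneg_right hZ.le hL.le
    have e : ((j + d : ℕ) : ℝ) / Real.log n * Real.log M * Real.log n
        = ((j + d : ℕ) : ℝ) * Real.log M := by
      have := hL.ne'
      field_simp
    rw [e] at hZ'
    have e2 : Real.sqrt (a * b / M) = 2 * s := by rw [hs]; ring
    have e3 : (-(a + b) / 2 + Real.sqrt (a * b / M) - ε) =
      (-a / 2 + s * (1 + Real.log (a / 2) - Real.log s) - ε / 3) +
      (-b / 2 + s * (1 + Real.log (b / 2) - Real.log s) - ε / 3) -
      (s * Real.log M + ε / 3) := by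
      rw [e2]
      linear_combination (-s) * key
    rw [e3]
    push_cast at *
    linarith
  · simp
  · intro k _
    have := aux_binom_nonneg N1 j _ hpa.1 hpa.2
    have := aux_binom_nonneg (n / 2) k _ hpb.1 hpb.2
    split_ifs <;> positivity
  · intro i _
    refine Finset.sum_nonneg fun k _ => ?_
    have := aux_binom_nonneg N1 i _ hpa.1 hpa.2
    have := aux_binom_nonneg (n / 2) k _ hpb.1 hpb.2
    split_ifs <;> positivity
end

section
/- For every β > 0 and every ε > 0 there exists N such that for all n ≥ N the following holds: with k_m = ⌈β·log n⌉, every tuple of nonnegative integers (r_1, …, r_{k_m}) satisfying ∑_{k=1}^{k_m} k·r_k = n obeys n^{(∑_{k=1}^{k_m} r_k)} / ∏_{k=1}^{k_m} (r_k)! ≤ n^{ε·n}. -/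
/-!
Lemma 6 of the paper: for `k_m = ⌈β log n⌉`, every tuple `(r_1, …, r_{k_m})` of
nonnegative integers with `∑ k·r_k = n` satisfies
`n^(∑ r_k) / ∏ (r_k)! ≤ n^(εn)` for all large `n`.
-/

open scoped BigOperators

theorem stirling_type_bound (β : ℝ) (hβ : 0 < β) :
    ∀ ε : ℝ, 0 < ε → ∃ N : ℕ, ∀ n : ℕ, N ≤ n →
      ∀ r : ℕ → ℕ,
        (∑ k ∈ Finset.Icc 1 ⌈β * Real.log n⌉₊, k * r k) = n →
        (n : ℝ) ^ (∑ k ∈ Finset.Icc 1 ⌈β * Real.log n⌉₊, r k) /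
            (∏ k ∈ Finset.Icc 1 ⌈β * Real.log n⌉₊, ((r k).factorial : ℝ))
          ≤ (n : ℝ) ^ (ε * n) := by
  intro ε hε
  obtain ⟨C, hC⟩ : ∃ C : ℝ, C = 1 + 2 * (β + 1) / ε := ⟨_, rfl⟩
  have hC1 : 1 ≤ C := by rw [hC]; have : 0 ≤ 2 * (β + 1) / ε := by positivity
                         linarith
  have hC0 : 0 < C := by linarith
  have hC2 : (β + 1) / C ≤ ε / 2 := by
    rw [div_le_iff₀ hC0, hC]
    have : ε / 2 * (1 + 2 * (β + 1) / ε) = ε / 2 + (β + 1) := by field_simp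
    linarith
  have hlog : Filter.Tendsto (fun n : ℕ => Real.log (n : ℝ)) Filter.atTop Filter.atTop :=
    Real.tendsto_log_atTop.comp tendsto_natCast_atTop_atTop
  obtain ⟨N, hN⟩ := Filter.eventually_atTop.1
    ((hlog.eventually_ge_atTop 1).and ((hlog.eventually_ge_atTop (2 * Real.log C / ε)).and
      (Filter.eventually_ge_atTop 1)))
  refine ⟨N, fun n hn r hr => ?_⟩
  obtain ⟨h1, h2, h3⟩ := hN n hn
  have hn0 : (0 : ℝ) < n := by exact_mod_cast h3
  have hK : (⌈β * Real.log n⌉₊ : ℝ) ≤ (β + 1) * Real.log n := by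
    have := Nat.ceil_lt_add_one (a := β * Real.log n) (by positivity)
    linarith
  generalize ⌈β * Real.log n⌉₊ = K at *
  have hS : (∑ k ∈ Finset.Icc 1 K, r k) ≤ n := by
    conv_rhs => rw [← hr]
    exact Finset.sum_le_sum fun k hk => Nat.le_mul_of_pos_left _ (Finset.mem_Icc.1 hk).1
  have hterm : ∀ k, (n : ℝ) ^ r k / ((r k).factorial : ℝ) ≤ Real.exp (n / C) * C ^ r k := by
    intro k
    have h := Real.pow_div_factorial_le_exp ((n : ℝ) / C) (by positivity) (r k)
    calc (n : ℝ) ^ r k / ((r k).factorial : ℝ)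
        = ((n : ℝ) / C) ^ r k / ((r k).factorial : ℝ) * C ^ r k := by
          rw [div_pow]; field_simp
      _ ≤ _ := by gcongr
  have hlc : Real.log C ≤ ε / 2 * Real.log n := by
    rw [div_le_iff₀ hε] at h2; linarith
  calc (n : ℝ) ^ (∑ k ∈ Finset.Icc 1 K, r k) / (∏ k ∈ Finset.Icc 1 K, ((r k).factorial : ℝ))
      = ∏ k ∈ Finset.Icc 1 K, (n : ℝ) ^ r k / ((r k).factorial : ℝ) := by
        rw [Finset.prod_div_distrib, Finset.prod_pow_eq_pow_sum]
    _ ≤ ∏ k ∈ Finset.Icc 1 K, Real.exp (n / C) * C ^ r k :=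
        Finset.prod_le_prod (fun k _ => by positivity) (fun k _ => hterm k)
    _ = Real.exp (n / C) ^ K * C ^ (∑ k ∈ Finset.Icc 1 K, r k) := by
        rw [Finset.prod_mul_distrib, Finset.prod_pow_eq_pow_sum]; simp
    _ ≤ Real.exp (n / C) ^ K * C ^ n := by gcongr
    _ = Real.exp (K * (n / C) + n * Real.log C) := by
        rw [Real.exp_add, Real.exp_nat_mul, Real.exp_nat_mul, Real.exp_log hC0]
    _ ≤ Real.exp (Real.log n * (ε * n)) := by
        apply Real.exp_le_exp.2
        have a1 : (K : ℝ) * (n / C) ≤ (ε / 2) * (Real.log n * n) := by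
          calc (K : ℝ) * (n / C) ≤ ((β + 1) * Real.log n) * (n / C) := by gcongr
            _ = (β + 1) / C * (Real.log n * n) := by ring
            _ ≤ _ := by gcongr
        have a2 : (n : ℝ) * Real.log C ≤ n * (ε / 2 * Real.log n) := by gcongr
        linarith
    _ = (n : ℝ) ^ (ε * n) := by rw [Real.rpow_def_of_pos hn0]
end

section
/- Fix an integer k ≥ 2 and define h̃ : [0,∞) → ℝ by h̃(x) = 1/(1−x) − k·x^k/(1−x^k) for x ≠ 1 and h̃(1) = (k+1)/2. Then h̃ is continuous on [0,∞), monotonically increasing on [0,∞), satisfies h̃(0) = 1, and h̃(x) → k as x → ∞. -/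
/-!
Properties of the auxiliary function
`h̃(x) = 1/(1−x) − k·x^k/(1−x^k)` (with `h̃(1) = (k+1)/2`) used in the proof of
Lemma 6: it is continuous and monotonically increasing on `[0,∞)`, satisfies
`h̃(0) = 1`, and tends to `k` as `x → ∞`.
-/

theorem aux_geom (k : ℕ) (x : ℝ) :
    (1 - x) * ∑ m ∈ Finset.range k, x ^ m = 1 - x ^ k := by
  induction k with
  | zero => simp
  | succ k ih => rw [Finset.sum_range_succ, mul_add, ih]; ring

theorem aux_num (k : ℕ) (x : ℝ) :
    (1 - x) * ∑ m ∈ Finset.range k, ((m : ℝ) + 1) * x ^ m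
      = ∑ m ∈ Finset.range k, x ^ m - k * x ^ k := by
  induction k with
  | zero => simp
  | succ k ih =>
    rw [Finset.sum_range_succ, Finset.sum_range_succ, mul_add, ih]; push_cast; ring

theorem aux_one (k : ℕ) : ∑ m ∈ Finset.range k, ((m : ℝ) + 1) = k * (k + 1) / 2 := by
  induction k with
  | zero => simp
  | succ k ih => rw [Finset.sum_range_succ, ih]; push_cast; ring

theorem aux_mono (k : ℕ) (x y : ℝ) (hx : 0 ≤ x) (hxy : x ≤ y) :
    (∑ m ∈ Finset.range k, ((m : ℝ) + 1) * x ^ m) * (∑ m ∈ Finset.range k, y ^ m)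
      ≤ (∑ m ∈ Finset.range k, ((m : ℝ) + 1) * y ^ m) * (∑ m ∈ Finset.range k, x ^ m) := by
  induction k with
  | zero => simp
  | succ k ih =>
    have key : 0 ≤ ∑ m ∈ Finset.range k, ((k : ℝ) - m) * (y ^ k * x ^ m - x ^ k * y ^ m) := by
      apply Finset.sum_nonneg
      intro m hm
      have hm' : m < k := Finset.mem_range.mp hm
      obtain ⟨d, rfl⟩ := Nat.exists_eq_add_of_lt hm'
      have e : y ^ (m + d + 1) * x ^ m - x ^ (m + d + 1) * y ^ m
          = x ^ m * y ^ m * (y ^ (d + 1) - x ^ (d + 1)) := by ring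
      rw [e]
      have hy : 0 ≤ y := hx.trans hxy
      have h1 : x ^ (d + 1) ≤ y ^ (d + 1) := pow_le_pow_left₀ hx hxy _
      apply mul_nonneg
      · push_cast; linarith [(Nat.cast_nonneg d : (0 : ℝ) ≤ d)]
      · exact mul_nonneg (by positivity) (by linarith)
    have e : ∑ m ∈ Finset.range k, ((k : ℝ) - m) * (y ^ k * x ^ m - x ^ k * y ^ m)
        = (k + 1) * y ^ k * (∑ m ∈ Finset.range k, x ^ m)
          - (k + 1) * x ^ k * (∑ m ∈ Finset.range k, y ^ m)
          - y ^ k * (∑ m ∈ Finset.range k, ((m : ℝ) + 1) * x ^ m)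
          + x ^ k * (∑ m ∈ Finset.range k, ((m : ℝ) + 1) * y ^ m) := by
      simp only [Finset.mul_sum, ← Finset.sum_sub_distrib, ← Finset.sum_add_distrib]
      apply Finset.sum_congr rfl
      intros; ring
    rw [e] at key
    simp only [Finset.sum_range_succ]
    nlinarith [key, ih]

theorem htilde_properties (k : ℕ) (hk : 2 ≤ k) (h : ℝ → ℝ)
    (hdef : ∀ x : ℝ, 0 ≤ x → x ≠ 1 →
      h x = 1 / (1 - x) - (k : ℝ) * x ^ k / (1 - x ^ k))
    (h1 : h 1 = ((k : ℝ) + 1) / 2) :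
    ContinuousOn h (Set.Ici 0) ∧ MonotoneOn h (Set.Ici 0) ∧ h 0 = 1 ∧
      Filter.Tendsto h Filter.atTop (nhds (k : ℝ)) := by
  have hk0 : k ≠ 0 := by omega
  have hkR : (k : ℝ) ≠ 0 := by exact_mod_cast hk0
  have Spos : ∀ x : ℝ, 0 ≤ x → 0 < ∑ m ∈ Finset.range k, x ^ m := fun x hx =>
    Finset.sum_pos' (fun m _ => by positivity)
      ⟨0, Finset.mem_range.mpr (by omega), by simp⟩
  have heq : ∀ x ∈ Set.Ici (0 : ℝ), h x =
      (∑ m ∈ Finset.range k, ((m : ℝ) + 1) * x ^ m) / ∑ m ∈ Finset.range k, x ^ m := by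
    intro x hx
    have hS := (Spos x hx).ne'
    by_cases hx1 : x = 1
    · subst hx1
      simp only [one_pow, mul_one, aux_one, h1]
      simp
      field_simp
    · have hd : 1 - x ≠ 0 := sub_ne_zero.mpr (Ne.symm hx1)
      have hn := aux_num k x
      rw [hdef x hx hx1, ← aux_geom k x]
      rw [eq_comm, div_eq_iff hS]
      field_simp
      linarith
  refine ⟨?_, ?_, ?_, ?_⟩
  · refine ContinuousOn.congr ?_ heq
    apply ContinuousOn.div
    · fun_prop
    · fun_prop
    · intro x hx; exact (Spos x hx).ne'
  · intro x hx y hy hxy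
    rw [heq x hx, heq y hy, div_le_div_iff₀ (Spos x hx) (Spos y hy)]
    exact aux_mono k x y hx hxy
  · rw [hdef 0 le_rfl (by norm_num)]; simp [hk0]
  · have a0 : Filter.Tendsto (fun x : ℝ => 1 - x) Filter.atTop Filter.atBot := by
      simp only [sub_eq_add_neg]
      exact Filter.tendsto_atBot_add_const_left Filter.atTop (1 : ℝ)
        Filter.tendsto_neg_atTop_atBot
    have a1 : Filter.Tendsto (fun x : ℝ => (1 - x)⁻¹) Filter.atTop (nhds 0) :=
      tendsto_inv_atBot_zero.comp a0
    have a2 := a1.comp (Filter.tendsto_pow_atTop (α := ℝ) hk0)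
    have a3 := a1.sub ((a2.sub_const 1).const_mul (k : ℝ))
    have e : (0 : ℝ) - k * (0 - 1) = k := by ring
    rw [e] at a3
    refine a3.congr' ?_
    filter_upwards [Filter.eventually_gt_atTop (1 : ℝ)] with x hx
    have hp : 1 < x ^ k := one_lt_pow₀ hx hk0
    rw [hdef x (by linarith) hx.ne']
    have hq : 1 - x ^ k ≠ 0 := by linarith
    have hq' : 1 - x ≠ 0 := by linarith
    simp only [Function.comp]
    field_simp
    ring
end
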